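/- Let q, a be complex numbers with |q| < 1, |a| < 1, and 1 - a q^n ≠ 0 for all n ≥ 0. Then ∑_{n=1}^∞ ( a^n (q;q)_{n-1} ) / ( (1 - q^n) (a;q)_n ) = ∑_{n=1}^∞ ( n a^n ) / (1 - q^n). -/

import Mathlib

/-- The finite q-Pochhammer symbol `(A;q)_n = (1-A)(1-Aq)⋯(1-Aq^{n-1})`. -/
noncomputable def qPoch (q A : ℂ) (n : ℕ) : ℂ := ∏ k ∈ Finset.range n, (1 - A * q ^ k)

/-- The infinite q-Pochhammer symbol `(A;q)_∞ = ∏_{k≥0} (1 - A q^k)`. -/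
noncomputable def qPochInf (q A : ℂ) : ℂ := ∏' k : ℕ, (1 - A * q ^ k)

open Filter Topology

lemma qPoch_succ (q A : ℂ) (n : ℕ) : qPoch q A (n + 1) = qPoch q A n * (1 - A * q ^ n) :=
  Finset.prod_range_succ _ _

lemma qPoch_add (q A : ℂ) (m n : ℕ) :
    qPoch q A (m + n) = qPoch q A m * qPoch q (A * q ^ m) n := by
  simp only [qPoch, Finset.prod_range_add]
  congr 1
  exact Finset.prod_congr rfl fun k _ ↦ by ring

lemma qPoch_ne_zero {q A : ℂ} (hA : ∀ n : ℕ, 1 - A * q ^ n ≠ 0) (n : ℕ) : qPoch q A n ≠ 0 :=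
  Finset.prod_ne_zero_iff.2 fun k _ ↦ hA k

lemma one_sub_pow_succ_ne_zero {q : ℂ} (hq : ‖q‖ < 1) (n : ℕ) : 1 - q ^ (n + 1) ≠ 0 := by
  intro h
  have h2 : ‖q ^ (n + 1)‖ < 1 := by
    rw [norm_pow]; exact pow_lt_one₀ (norm_nonneg _) hq (by omega)
  rw [← sub_eq_zero.1 h] at h2
  simp at h2

lemma norm_inv_one_sub_pow_succ_le {q : ℂ} (hq : ‖q‖ < 1) (n : ℕ) :
    ‖(1 - q ^ (n + 1))⁻¹‖ ≤ (1 - ‖q‖)⁻¹ := by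
  rw [norm_inv]
  refine inv_anti₀ (by linarith) ?_
  have h1 : ‖q ^ (n + 1)‖ ≤ ‖q‖ := by
    rw [norm_pow]; exact pow_le_of_le_one (norm_nonneg _) hq.le (by omega)
  have h2 := norm_sub_norm_le (1 : ℂ) (q ^ (n + 1))
  rw [norm_one] at h2
  linarith

lemma summable_norm_neg_mul_pow {q : ℂ} (hq : ‖q‖ < 1) (A : ℂ) :
    Summable fun n : ℕ ↦ ‖-(A * q ^ n)‖ := by
  simp only [norm_neg, norm_mul, norm_pow]
  exact (summable_geometric_of_lt_one (norm_nonneg _) hq).mul_left _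

lemma tendsto_qPoch {q : ℂ} (hq : ‖q‖ < 1) (A : ℂ) :
    Tendsto (qPoch q A) atTop (𝓝 (qPochInf q A)) := by
  have h := (multipliable_one_add_of_summable
    (summable_norm_neg_mul_pow hq A)).tendsto_prod_tprod_nat
  simp only [← sub_eq_add_neg] at h
  exact h

lemma qPochInf_ne_zero {q A : ℂ} (hq : ‖q‖ < 1) (hA : ∀ n : ℕ, 1 - A * q ^ n ≠ 0) :
    qPochInf q A ≠ 0 := by
  have h := tprod_one_add_ne_zero_of_summable (f := fun n : ℕ ↦ -(A * q ^ n))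
    (fun n ↦ by simpa only [← sub_eq_add_neg] using hA n) (summable_norm_neg_mul_pow hq A)
  simp only [← sub_eq_add_neg] at h
  exact h

lemma exists_norm_qPoch_le {q : ℂ} (hq : ‖q‖ < 1) (A : ℂ) :
    ∃ M : ℝ, ∀ n, ‖qPoch q A n‖ ≤ M := by
  obtain ⟨M, hM⟩ := (Metric.isBounded_range_of_tendsto _ (tendsto_qPoch hq A)).exists_norm_le
  exact ⟨M, fun n ↦ hM _ ⟨n, rfl⟩⟩

lemma exists_norm_inv_qPoch_le {q A : ℂ} (hq : ‖q‖ < 1) (hA : ∀ n : ℕ, 1 - A * q ^ n ≠ 0) :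
    ∃ M : ℝ, ∀ N n, ‖(qPoch q (A * q ^ N) n)⁻¹‖ ≤ M := by
  obtain ⟨K, hK⟩ := exists_norm_qPoch_le hq A
  obtain ⟨L, hL⟩ := (Metric.isBounded_range_of_tendsto _
    ((tendsto_qPoch hq A).inv₀ (qPochInf_ne_zero hq hA))).exists_norm_le
  refine ⟨K * L, fun N n ↦ ?_⟩
  have h : (qPoch q (A * q ^ N) n)⁻¹ = qPoch q A N * (qPoch q A (N + n))⁻¹ := by
    rw [qPoch_add, mul_inv, mul_inv_cancel_left₀ (qPoch_ne_zero hA N)]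
  rw [h, norm_mul]
  exact mul_le_mul (hK N) (hL _ ⟨N + n, rfl⟩) (norm_nonneg _) ((norm_nonneg _).trans (hK N))

/-- The summand of the left-hand series. -/
noncomputable def qPochTerm (q a : ℂ) (n : ℕ) : ℂ :=
  (a ^ (n + 1) * qPoch q q n) / ((1 - q ^ (n + 1)) * qPoch q a (n + 1))

/-- The summand of the right-hand Lambert series. -/
noncomputable def lambertTerm (q a : ℂ) (n : ℕ) : ℂ :=
  ((n + 1 : ℂ) * a ^ (n + 1)) / (1 - q ^ (n + 1))

lemma norm_mul_pow_pow_succ_le {q : ℂ} (hq : ‖q‖ < 1) (a : ℂ) (N n : ℕ) :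
    ‖(a * q ^ N) ^ (n + 1)‖ ≤ ‖q‖ ^ N * ‖a‖ ^ (n + 1) := by
  rw [norm_pow, norm_mul, norm_pow, mul_pow, mul_comm]
  gcongr
  exact pow_le_of_le_one (by positivity) (pow_le_one₀ (norm_nonneg _) hq.le) (by omega)

lemma exists_norm_qPochTerm_le {q a : ℂ} (hq : ‖q‖ < 1) (haa : ‖a‖ < 1)
    (ha : ∀ n : ℕ, 1 - a * q ^ n ≠ 0) :
    ∃ b : ℕ → ℝ, Summable b ∧ ∀ N n, ‖qPochTerm q (a * q ^ N) n‖ ≤ ‖q‖ ^ N * b n := by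
  obtain ⟨K, hK⟩ := exists_norm_qPoch_le hq q
  obtain ⟨L, hL⟩ := exists_norm_inv_qPoch_le hq ha
  have hK0 : 0 ≤ K := (norm_nonneg _).trans (hK 0)
  have hq0 : 0 ≤ (1 - ‖q‖)⁻¹ := inv_nonneg.2 (by linarith)
  refine ⟨fun n ↦ ‖a‖ ^ (n + 1) * (K * ((1 - ‖q‖)⁻¹ * L)), ?_, fun N n ↦ ?_⟩
  · exact ((summable_nat_add_iff 1).2
      (summable_geometric_of_lt_one (norm_nonneg _) haa)).mul_right _
  · rw [qPochTerm, div_eq_mul_inv, mul_inv, norm_mul, norm_mul, norm_mul, mul_assoc, ← mul_assoc (‖q‖ ^ N)]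
    exact mul_le_mul (norm_mul_pow_pow_succ_le hq a N n)
      (mul_le_mul (hK n) (mul_le_mul (norm_inv_one_sub_pow_succ_le hq n) (hL _ _)
        (norm_nonneg _) hq0) (by positivity) hK0) (by positivity) (by positivity)

lemma exists_norm_lambertTerm_le {q a : ℂ} (hq : ‖q‖ < 1) (haa : ‖a‖ < 1) :
    ∃ b : ℕ → ℝ, Summable b ∧ ∀ N n, ‖lambertTerm q (a * q ^ N) n‖ ≤ ‖q‖ ^ N * b n := by
  refine ⟨fun n ↦ ((n + 1 : ℕ) : ℝ) * ‖a‖ ^ (n + 1) * (1 - ‖q‖)⁻¹, ?_, fun N n ↦ ?_⟩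
  · have hs : Summable fun n : ℕ ↦ (n : ℝ) * ‖a‖ ^ n := by
      simpa using summable_pow_mul_geometric_of_norm_lt_one (R := ℝ) (r := ‖a‖) 1
        (by simpa using haa)
    exact ((summable_nat_add_iff 1).2 hs).mul_right _
  · have h : ‖((n : ℂ) + 1)‖ = ((n + 1 : ℕ) : ℝ) := by
      rw [← Nat.cast_succ, Complex.norm_natCast]
    rw [lambertTerm, div_eq_mul_inv, norm_mul, norm_mul, h]
    calc _ ≤ ((n + 1 : ℕ) : ℝ) * (‖q‖ ^ N * ‖a‖ ^ (n + 1)) * (1 - ‖q‖)⁻¹ := by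
          gcongr
          · exact norm_mul_pow_pow_succ_le hq a N n
          · exact norm_inv_one_sub_pow_succ_le hq n
      _ = _ := by ring

lemma tendsto_tsum_zero_of_norm_le_pow_mul {q : ℂ} (hq : ‖q‖ < 1) {f : ℕ → ℕ → ℂ} {b : ℕ → ℝ}
    (hb : Summable b) (h : ∀ N n, ‖f N n‖ ≤ ‖q‖ ^ N * b n) :
    Tendsto (fun N ↦ ∑' n, f N n) atTop (𝓝 0) := by
  refine squeeze_zero_norm (a := fun N ↦ ‖q‖ ^ N * ∑' n, b n)
    (fun N ↦ tsum_of_norm_bounded (hb.hasSum.mul_left _) (h N)) ?_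
  simpa using (tendsto_pow_atTop_nhds_zero_of_lt_one (norm_nonneg q) hq).mul_const (∑' n, b n)

lemma summable_qPochTerm {q a : ℂ} (hq : ‖q‖ < 1) (haa : ‖a‖ < 1)
    (ha : ∀ n : ℕ, 1 - a * q ^ n ≠ 0) : Summable (qPochTerm q a) := by
  obtain ⟨b, hb, h⟩ := exists_norm_qPochTerm_le hq haa ha
  exact Summable.of_norm_bounded hb fun n ↦ by simpa using h 0 n

lemma summable_lambertTerm {q a : ℂ} (hq : ‖q‖ < 1) (haa : ‖a‖ < 1) :
    Summable (lambertTerm q a) := by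
  obtain ⟨b, hb, h⟩ := exists_norm_lambertTerm_le hq haa
  exact Summable.of_norm_bounded hb fun n ↦ by simpa using h 0 n

lemma one_sub_mul_pow_mul_pow_ne_zero {q a : ℂ} (ha : ∀ n : ℕ, 1 - a * q ^ n ≠ 0) (N n : ℕ) :
    1 - a * q ^ N * q ^ n ≠ 0 := by
  rw [mul_assoc, ← pow_add]; exact ha _

lemma norm_mul_pow_lt_one {q a : ℂ} (hq : ‖q‖ < 1) (haa : ‖a‖ < 1) (N : ℕ) :
    ‖a * q ^ N‖ < 1 := by
  rw [norm_mul, norm_pow]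
  exact (mul_le_of_le_one_right (norm_nonneg _) (pow_le_one₀ (norm_nonneg _) hq.le)).trans_lt haa

lemma lambertTerm_sub {q : ℂ} (hq : ‖q‖ < 1) (a : ℂ) (n : ℕ) :
    lambertTerm q a n - lambertTerm q (a * q) n = ((n + 1 : ℕ) : ℂ) * a ^ (n + 1) := by
  have h := one_sub_pow_succ_ne_zero hq n
  rw [lambertTerm, lambertTerm, mul_pow, ← sub_div, div_eq_iff h]
  push_cast
  ring

/-- The difference of summands at `a` and `a q` telescopes in `n`. -/
lemma qPochTerm_sub {q a : ℂ} (hq : ‖q‖ < 1) (ha : ∀ n : ℕ, 1 - a * q ^ n ≠ 0) (n : ℕ) :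
    qPochTerm q a n - qPochTerm q (a * q) n =
      (1 - a)⁻¹ * (a ^ (n + 1) * qPoch q q n / qPoch q a (n + 1) -
        a ^ (n + 2) * qPoch q q (n + 1) / qPoch q a (n + 2)) := by
  have h := one_sub_pow_succ_ne_zero hq n
  have h0 : 1 - a ≠ 0 := by simpa using ha 0
  have h1 := ha (n + 1)
  have h2 := qPoch_ne_zero ha (n + 1)
  have h3 : qPoch q (a * q) (n + 1) = qPoch q a (n + 1) * (1 - a * q ^ (n + 1)) / (1 - a) := by
    have h4 := qPoch_add q a 1 (n + 1)
    rw [add_comm 1, qPoch_succ q a (n + 1), pow_one, show qPoch q a 1 = 1 - a by simp [qPoch]] at h4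
    rw [h4, mul_div_cancel_left₀ _ h0]
  rw [qPochTerm, qPochTerm, h3, qPoch_succ q a (n + 1), qPoch_succ q q n, ← pow_succ', mul_pow]
  generalize q ^ (n + 1) = x at *
  generalize qPoch q a (n + 1) = y at *
  have h1' : 1 - x * a ≠ 0 := by rwa [mul_comm x a]
  field_simp
  ring

lemma tsum_qPochTerm_sub {q a : ℂ} (hq : ‖q‖ < 1) (haa : ‖a‖ < 1)
    (ha : ∀ n : ℕ, 1 - a * q ^ n ≠ 0) :
    ∑' n, (qPochTerm q a n - qPochTerm q (a * q) n) = a / (1 - a) ^ 2 := by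
  set v : ℕ → ℂ := fun n ↦ a ^ (n + 1) * qPoch q q n / qPoch q a (n + 1) with hv
  have hs : Summable v := by
    refine Summable.of_norm_bounded ((summable_qPochTerm hq haa ha).norm.mul_left 2) fun n ↦ ?_
    have h := one_sub_pow_succ_ne_zero hq n
    have h1 : v n = (1 - q ^ (n + 1)) * qPochTerm q a n := by
      rw [hv, qPochTerm, mul_div_assoc', mul_div_mul_left _ _ h]
    rw [h1, norm_mul]
    gcongr
    refine (norm_sub_le _ _).trans ?_
    rw [norm_one, norm_pow]
    linarith [pow_le_one₀ (n := n + 1) (norm_nonneg q) hq.le]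
  have h0 : 1 - a ≠ 0 := by simpa using ha 0
  have hv0 : v 0 = a / (1 - a) := by simp [hv, qPoch]
  calc _ = ∑' n, (1 - a)⁻¹ * (v n - v (n + 1)) := tsum_congr (qPochTerm_sub hq ha)
    _ = (1 - a)⁻¹ * v 0 := by
        rw [tsum_mul_left, hs.tsum_sub ((summable_nat_add_iff 1).2 hs), hs.tsum_eq_zero_add,
          add_sub_cancel_right]
    _ = _ := by rw [hv0]; field_simp

lemma tsum_lambertTerm_sub {q a : ℂ} (hq : ‖q‖ < 1) (haa : ‖a‖ < 1) :
    ∑' n, (lambertTerm q a n - lambertTerm q (a * q) n) = a / (1 - a) ^ 2 := by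
  have hs : Summable fun n : ℕ ↦ (n : ℂ) * a ^ n := by
    simpa using summable_pow_mul_geometric_of_norm_lt_one 1 haa
  rw [tsum_congr (lambertTerm_sub hq a), ← tsum_coe_mul_geometric_of_norm_lt_one haa,
    hs.tsum_eq_zero_add]
  simp

lemma tsum_sub_tsum_mul_right {q a : ℂ} (hq : ‖q‖ < 1) (haa : ‖a‖ < 1)
    (ha : ∀ n : ℕ, 1 - a * q ^ n ≠ 0) :
    ∑' n, qPochTerm q (a * q) n - ∑' n, lambertTerm q (a * q) n =
      ∑' n, qPochTerm q a n - ∑' n, lambertTerm q a n := by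
  have haq : ‖a * q‖ < 1 := by simpa using norm_mul_pow_lt_one hq haa 1
  have ha' : ∀ n : ℕ, 1 - a * q * q ^ n ≠ 0 := by
    simpa using one_sub_mul_pow_mul_pow_ne_zero ha 1
  have h1 := tsum_qPochTerm_sub hq haa ha
  have h2 := tsum_lambertTerm_sub hq haa
  rw [(summable_qPochTerm hq haa ha).tsum_sub (summable_qPochTerm hq haq ha')] at h1
  rw [(summable_lambertTerm hq haa).tsum_sub (summable_lambertTerm hq haq)] at h2
  linear_combination h2 - h1

theorem stmt14 (q a : ℂ) (hq : ‖q‖ < 1) (haa : ‖a‖ < 1)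
    (ha : ∀ n : ℕ, 1 - a * q ^ n ≠ 0) :
    ∑' n : ℕ, (a ^ (n + 1) * qPoch q q n) / ((1 - q ^ (n + 1)) * qPoch q a (n + 1))
      = ∑' n : ℕ, ((n + 1 : ℂ) * a ^ (n + 1)) / (1 - q ^ (n + 1)) := by
  change ∑' n, qPochTerm q a n = ∑' n, lambertTerm q a n
  have hconst : ∀ N : ℕ,
      ∑' n, qPochTerm q (a * q ^ N) n - ∑' n, lambertTerm q (a * q ^ N) n =
        ∑' n, qPochTerm q a n - ∑' n, lambertTerm q a n := by
    intro N
    induction N with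
    | zero => simp
    | succ N ih =>
      rw [← ih, pow_succ, ← mul_assoc]
      exact tsum_sub_tsum_mul_right hq (norm_mul_pow_lt_one hq haa N)
        (one_sub_mul_pow_mul_pow_ne_zero ha N)
  obtain ⟨b, hb, hbound⟩ := exists_norm_qPochTerm_le hq haa ha
  obtain ⟨c, hc, hcbound⟩ := exists_norm_lambertTerm_le hq haa
  have hlim := (tendsto_tsum_zero_of_norm_le_pow_mul hq hb hbound).sub
    (tendsto_tsum_zero_of_norm_le_pow_mul hq hc hcbound)
  simp only [hconst, sub_zero] at hlim
  exact sub_eq_zero.1 (tendsto_nhds_unique tendsto_const_nhds hlim)
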